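/- Let g:ℝ²→ℝ be compactly supported and Lipschitz with respect to d̃, and for x∈ℝ³ with x₁≠0 set K₁(g)(x)=∫_{ℝ²} k₁(x,ŷ) g(ŷ) dŷ. Then for every x̂₀∈ℝ², K₁(g)(x) → (1/2)g(x̂₀) as x → (0,x̂₀) within {x₁>0}, and K₁(g)(x) → −(1/2)g(x̂₀) as x → (0,x̂₀) within {x₁<0}. -/

import Mathlib

open MeasureTheory Filter

noncomputable section

/-- The quantity `D(x, ŷ)` from the double layer potential kernels. -/
def Dden (x : ℝ × ℝ × ℝ) (y : ℝ × ℝ) : ℝ :=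
  (x.1 ^ 2 + (x.2.1 - y.1) ^ 2) ^ 2 + 16 * (x.2.2 - y.2 + (1 / 2) * y.1 * x.1) ^ 2

/-- The kernel `k₁(x, ŷ)`. -/
def k1 (c : ℝ) (x : ℝ × ℝ × ℝ) (y : ℝ × ℝ) : ℝ :=
  2 * c * (x.1 ^ 2 + (x.2.1 - y.1) ^ 2) * x.1 * Dden x y ^ (-(3 : ℝ) / 2)

/-- The kernel `k(x, ŷ)`. -/
def kker (c : ℝ) (x : ℝ × ℝ × ℝ) (y : ℝ × ℝ) : ℝ :=
  8 * c * (x.2.1 - y.1) * (x.2.2 - y.2 + (1 / 2) * y.1 * x.1) * Dden x y ^ (-(3 : ℝ) / 2)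

/-- The homogeneous distance `d̃` on the vertical plane `Π ≅ ℝ²`. -/
def dt (a b : ℝ × ℝ) : ℝ := ((a.1 - b.1) ^ 4 + 16 * (a.2 - b.2) ^ 2) ^ ((1 : ℝ) / 4)

/-- The ball of `d̃` of radius `r` centered at `a`. -/
def bhat (r : ℝ) (a : ℝ × ℝ) : Set (ℝ × ℝ) := {b | dt a b < r}

/-- The candidate fundamental solution `Γ_c(x, y)` on the first Heisenberg group. -/
def Gam (c : ℝ) (x y : ℝ × ℝ × ℝ) : ℝ :=
  c * (((x.1 - y.1) ^ 2 + (x.2.1 - y.2.1) ^ 2) ^ 2 +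
    16 * (x.2.2 - y.2.2 - (1 / 2) * (y.1 * x.2.1 - y.2.1 * x.1)) ^ 2) ^ (-(1 : ℝ) / 2)

/-- Derivative along the left-invariant vector field `X₁ = ∂₁ - (x₂/2) ∂₃`. -/
def X1d (f : ℝ × ℝ × ℝ → ℝ) (x : ℝ × ℝ × ℝ) : ℝ :=
  fderiv ℝ f x ((1 : ℝ), (0 : ℝ), -(x.2.1 / 2))

/-- Derivative along the left-invariant vector field `X₂ = ∂₂ + (x₁/2) ∂₃`. -/
def X2d (f : ℝ × ℝ × ℝ → ℝ) (x : ℝ × ℝ × ℝ) : ℝ :=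
  fderiv ℝ f x ((0 : ℝ), (1 : ℝ), x.1 / 2)

/-- The sub-Laplacian `Δ_ℍ = X₁² + X₂²`. -/
def subLap (f : ℝ × ℝ × ℝ → ℝ) (x : ℝ × ℝ × ℝ) : ℝ :=
  X1d (X1d f) x + X2d (X2d f) x

/-- `c` is the normalizing constant making `Γ_c` the fundamental solution of `Δ_ℍ`. -/
def IsNormalizing (c : ℝ) : Prop :=
  ∀ φ : ℝ × ℝ × ℝ → ℝ, ContDiff ℝ (⊤ : ℕ∞) φ → HasCompactSupport φ →
    ∫ y, Gam c 0 y * subLap φ y = -φ 0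

/-- The rescaled kernel. -/
def pker (c : ℝ) (p : ℝ × ℝ) : ℝ :=
  2 * c * (1 + p.1 ^ 2) * ((1 + p.1 ^ 2) ^ 2 + 16 * p.2 ^ 2) ^ (-(3 : ℝ) / 2)

theorem hasDerivAt_div_sqrt_one_add_sq (t : ℝ) :
    HasDerivAt (fun t : ℝ => t / √(1 + t ^ 2)) ((1 + t ^ 2) ^ (-(3 : ℝ) / 2)) t := by
  have hpos : 0 < 1 + t ^ 2 := by positivity
  have h1 : HasDerivAt (fun t : ℝ => 1 + t ^ 2) (2 * t) t := by
    simpa using (hasDerivAt_pow 2 t).const_add 1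
  have h2 := (hasDerivAt_id t).div (h1.sqrt hpos.ne') (Real.sqrt_pos.2 hpos).ne'
  refine h2.congr_deriv ?_
  have hs : (1 + t ^ 2) ^ (-(3 : ℝ) / 2) = (√(1 + t ^ 2) ^ 3)⁻¹ := by
    rw [Real.sqrt_eq_rpow, ← Real.rpow_natCast _ 3, ← Real.rpow_mul hpos.le,
      ← Real.rpow_neg hpos.le]
    norm_num
  have hsq := Real.sq_sqrt hpos.le
  have hsp := Real.sqrt_pos.2 hpos
  rw [hs]
  simp only [id]
  generalize √(1 + t ^ 2) = s at hsq hsp ⊢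
  field_simp
  linarith

theorem integrable_one_add_sq_rpow :
    Integrable (fun t : ℝ => (1 + t ^ 2) ^ (-(3 : ℝ) / 2)) := by
  refine integrable_inv_one_add_sq.mono' ?_ (ae_of_all _ fun t => ?_)
  · exact (Continuous.rpow_const (by fun_prop) fun t => Or.inl (by positivity)).aestronglyMeasurable
  · have h1 : 1 ≤ 1 + t ^ 2 := by nlinarith [sq_nonneg t]
    rw [Real.norm_of_nonneg (by positivity), ← Real.rpow_neg_one]
    exact Real.rpow_le_rpow_of_exponent_le h1 (by norm_num)

theorem tendsto_div_sqrt_one_add_sq_atTop :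
    Tendsto (fun t : ℝ => t / √(1 + t ^ 2)) atTop (nhds 1) := by
  have h : Tendsto (fun t : ℝ => (√((t ^ 2)⁻¹ + 1))⁻¹) atTop (nhds (√(0 + 1))⁻¹) := by
    refine Tendsto.inv₀ (Tendsto.sqrt (Tendsto.add_const _ ?_)) (by simp)
    exact tendsto_inv_atTop_zero.comp (tendsto_pow_atTop two_ne_zero)
  simp only [zero_add, Real.sqrt_one, inv_one] at h
  refine h.congr' ?_
  filter_upwards [eventually_gt_atTop 0] with t ht
  have : 1 + t ^ 2 = t ^ 2 * ((t ^ 2)⁻¹ + 1) := by field_simp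
  rw [this, Real.sqrt_mul (by positivity), Real.sqrt_sq ht.le]
  field_simp

theorem integral_one_add_sq_rpow : ∫ t : ℝ, (1 + t ^ 2) ^ (-(3 : ℝ) / 2) = 2 := by
  have hbot : Tendsto (fun t : ℝ => t / √(1 + t ^ 2)) atBot (nhds (-1)) := by
    have := (tendsto_div_sqrt_one_add_sq_atTop.comp tendsto_neg_atBot_atTop).neg
    refine this.congr fun t => ?_
    simp [neg_div]
  rw [integral_of_hasDerivAt_of_tendsto hasDerivAt_div_sqrt_one_add_sq
    integrable_one_add_sq_rpow hbot tendsto_div_sqrt_one_add_sq_atTop]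
  norm_num

theorem sq_add_sq_rpow_eq {A : ℝ} (hA : 0 < A) (b : ℝ) :
    (A ^ 2 + 16 * b ^ 2) ^ (-(3 : ℝ) / 2) =
      (A ^ 3)⁻¹ * (1 + (4 / A * b) ^ 2) ^ (-(3 : ℝ) / 2) := by
  have h : A ^ 2 + 16 * b ^ 2 = A ^ 2 * (1 + (4 / A * b) ^ 2) := by field_simp; ring
  rw [h, Real.mul_rpow (by positivity) (by positivity), ← Real.rpow_natCast A 2,
    ← Real.rpow_mul hA.le, ← Real.rpow_natCast A 3, ← Real.rpow_neg hA.le]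
  norm_num

theorem integrable_sq_add_sq_rpow {A : ℝ} (hA : 0 < A) :
    Integrable (fun b : ℝ => (A ^ 2 + 16 * b ^ 2) ^ (-(3 : ℝ) / 2)) := by
  simp_rw [sq_add_sq_rpow_eq hA]
  exact (integrable_one_add_sq_rpow.comp_mul_left' (by positivity)).const_mul _

theorem integral_sq_add_sq_rpow {A : ℝ} (hA : 0 < A) :
    ∫ b : ℝ, (A ^ 2 + 16 * b ^ 2) ^ (-(3 : ℝ) / 2) = (2 * A ^ 2)⁻¹ := by
  simp_rw [sq_add_sq_rpow_eq hA]
  rw [integral_const_mul, Measure.integral_comp_mul_left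
    (fun t : ℝ => (1 + t ^ 2) ^ (-(3 : ℝ) / 2)), integral_one_add_sq_rpow,
    abs_of_pos (by positivity), smul_eq_mul]
  field_simp
  norm_num

theorem continuous_pker (c : ℝ) : Continuous (pker c) := by
  unfold pker
  exact Continuous.mul (by fun_prop)
    (Continuous.rpow_const (by fun_prop) fun p => Or.inl (by positivity))

theorem integral_pker_right (c a : ℝ) : ∫ b, pker c (a, b) = c * (1 + a ^ 2)⁻¹ := by
  simp only [pker]
  rw [integral_const_mul, integral_sq_add_sq_rpow (by positivity)]
  field_simp

theorem pker_nonneg {c : ℝ} (hc : 0 ≤ c) (p : ℝ × ℝ) : 0 ≤ pker c p := by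
  unfold pker; positivity

theorem integrable_pker {c : ℝ} (hc : 0 ≤ c) : Integrable (pker c) := by
  rw [Measure.volume_eq_prod, integrable_prod_iff (continuous_pker c).aestronglyMeasurable]
  refine ⟨ae_of_all _ fun a => ?_, ?_⟩
  · exact (integrable_sq_add_sq_rpow (A := 1 + a ^ 2) (by positivity)).const_mul
      (2 * c * (1 + a ^ 2))
  · simp_rw [Real.norm_of_nonneg (pker_nonneg hc _), integral_pker_right]
    exact integrable_inv_one_add_sq.const_mul c

theorem integral_pker {c : ℝ} (hc : 0 ≤ c) : ∫ p, pker c p = c * Real.pi := by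
  have h := integrable_pker hc
  rw [Measure.volume_eq_prod] at h ⊢
  rw [integral_prod _ h]
  simp_rw [integral_pker_right]
  rw [integral_const_mul, integral_univ_inv_one_add_sq]

theorem continuous_k1 (c : ℝ) {x : ℝ × ℝ × ℝ} (hx : x.1 ≠ 0) : Continuous (k1 c x) := by
  have : 0 < x.1 ^ 2 := by positivity
  unfold k1 Dden
  refine Continuous.mul (by fun_prop)
    (Continuous.rpow_const (by fun_prop) fun p => Or.inl (ne_of_gt ?_))
  have : 0 < x.1 ^ 2 + (x.2.1 - p.1) ^ 2 := add_pos_of_pos_of_nonneg this (sq_nonneg _)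
  exact add_pos_of_pos_of_nonneg (pow_pos this 2) (by positivity)

theorem k1_rescale (c : ℝ) {x : ℝ × ℝ × ℝ} (hx : x.1 ≠ 0) (a b : ℝ) :
    |x.1| * (x.1 ^ 2 * k1 c x
      (x.1 * a + x.2.1, x.1 ^ 2 * b + (x.2.2 + (1 / 2) * (x.1 * a + x.2.1) * x.1))) =
      SignType.sign x.1 * pker c (a, b) := by
  have hp : 0 < |x.1| := abs_pos.2 hx
  have hD : Dden x (x.1 * a + x.2.1, x.1 ^ 2 * b + (x.2.2 + (1 / 2) * (x.1 * a + x.2.1) * x.1)) =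
      |x.1| ^ 4 * ((1 + a ^ 2) ^ 2 + 16 * b ^ 2) := by
    have : |x.1| ^ 4 = x.1 ^ 4 := by
      rw [show (4 : ℕ) = 2 * 2 from rfl, pow_mul, sq_abs, ← pow_mul]
    rw [this]; simp only [Dden]; ring
  have h6 : (|x.1| ^ 4) ^ (-(3 : ℝ) / 2) = (|x.1| ^ 6)⁻¹ := by
    rw [← Real.rpow_natCast, ← Real.rpow_mul hp.le, ← Real.rpow_natCast, ← Real.rpow_neg hp.le]
    norm_num
  have hs : (SignType.sign x.1 : ℝ) = x.1 / |x.1| := by rw [eq_div_iff hp.ne', sign_mul_abs]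
  have hsq : x.1 ^ 2 = |x.1| ^ 2 := (sq_abs _).symm
  simp only [k1, hD, pker]
  rw [Real.mul_rpow (by positivity) (by positivity), h6]
  have e : x.1 ^ 2 + (x.2.1 - (x.1 * a + x.2.1)) ^ 2 = |x.1| ^ 2 * (1 + a ^ 2) := by
    rw [← hsq]; ring
  rw [e, hsq, hs]
  field_simp

theorem integral_k1_mul_eq (c : ℝ) {g : ℝ × ℝ → ℝ} (hgc : Continuous g) (hg : HasCompactSupport g)
    {x : ℝ × ℝ × ℝ} (hx : x.1 ≠ 0)
    (hI : Integrable fun p : ℝ × ℝ => pker c p * g (x.1 * p.1 + x.2.1,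
      x.1 ^ 2 * p.2 + (x.2.2 + (1 / 2) * (x.1 * p.1 + x.2.1) * x.1))) :
    ∫ y, k1 c x y * g y = SignType.sign x.1 * ∫ p : ℝ × ℝ, pker c p * g (x.1 * p.1 + x.2.1,
      x.1 ^ 2 * p.2 + (x.2.2 + (1 / 2) * (x.1 * p.1 + x.2.1) * x.1)) := by
  have hF : Integrable fun y => k1 c x y * g y :=
    ((continuous_k1 c hx).mul hgc).integrable_of_hasCompactSupport hg.mul_left
  rw [Measure.volume_eq_prod] at hF hI ⊢
  rw [integral_prod _ hF, integral_prod _ hI, ← integral_const_mul]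
  have houter : ∀ u : ℝ → ℝ, ∫ y, u y = |x.1| * ∫ a, u (x.1 * a + x.2.1) := by
    intro u
    rw [Measure.integral_comp_mul_left (fun t => u (t + x.2.1)), integral_add_right_eq_self,
      abs_inv, smul_eq_mul, mul_inv_cancel_left₀ (abs_pos.2 hx).ne']
  have hinner : ∀ (u : ℝ → ℝ) (s : ℝ), ∫ y, u y = x.1 ^ 2 * ∫ b, u (x.1 ^ 2 * b + s) := by
    intro u s
    rw [Measure.integral_comp_mul_left (fun t => u (t + s)), integral_add_right_eq_self,
      abs_inv, smul_eq_mul, abs_of_nonneg (sq_nonneg _), mul_inv_cancel_left₀ (pow_ne_zero _ hx)]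
  rw [houter, ← integral_const_mul]
  congr 1 with a
  rw [hinner _ (x.2.2 + (1 / 2) * (x.1 * a + x.2.1) * x.1), ← integral_const_mul,
    ← integral_const_mul, ← integral_const_mul]
  congr 1 with b
  simp only
  rw [← mul_assoc (_ : ℝ) (pker c (a, b)), ← k1_rescale c hx]
  ring

theorem continuous_of_dt_lipschitz {g : ℝ × ℝ → ℝ} {L : ℝ}
    (hLip : ∀ a b : ℝ × ℝ, |g a - g b| ≤ L * dt a b) : Continuous g := by
  refine continuous_iff_continuousAt.2 fun b => ?_
  rw [ContinuousAt, tendsto_iff_dist_tendsto_zero]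
  have hd : Continuous fun a => L * dt a b := by
    unfold dt
    exact continuous_const.mul
      (Continuous.rpow_const (by fun_prop) fun p => Or.inr (by norm_num))
  have h0 := hd.tendsto b
  have : L * dt b b = 0 := by simp [dt]
  rw [this] at h0
  exact squeeze_zero (fun _ => dist_nonneg) (fun a => hLip a b) h0

theorem tendsto_integral_pker_mul {c : ℝ} (hc : 0 ≤ c) {g : ℝ × ℝ → ℝ} (hgc : Continuous g)
    (hg : HasCompactSupport g) (x0 : ℝ × ℝ) :
    Tendsto (fun x : ℝ × ℝ × ℝ => ∫ p : ℝ × ℝ, pker c p * g (x.1 * p.1 + x.2.1,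
      x.1 ^ 2 * p.2 + (x.2.2 + (1 / 2) * (x.1 * p.1 + x.2.1) * x.1)))
      (nhds ((0 : ℝ), x0.1, x0.2)) (nhds (c * Real.pi * g x0)) := by
  obtain ⟨M, hM⟩ := hgc.bounded_above_of_compact_support hg
  have h := tendsto_integral_filter_of_dominated_convergence (μ := volume)
    (l := nhds ((0 : ℝ), x0.1, x0.2)) (F := fun (x : ℝ × ℝ × ℝ) (p : ℝ × ℝ) =>
      pker c p * g (x.1 * p.1 + x.2.1,
        x.1 ^ 2 * p.2 + (x.2.2 + (1 / 2) * (x.1 * p.1 + x.2.1) * x.1)))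
    (f := fun p => pker c p * g x0) (fun p => pker c p * M) ?_ ?_ ?_ ?_
  · rwa [integral_mul_const, integral_pker hc] at h
  · exact Eventually.of_forall fun x =>
      ((continuous_pker c).mul (hgc.comp (by fun_prop))).aestronglyMeasurable
  · refine Eventually.of_forall fun x => ae_of_all _ fun p => ?_
    rw [norm_mul, Real.norm_of_nonneg (pker_nonneg hc _)]
    exact mul_le_mul_of_nonneg_left (hM _) (pker_nonneg hc _)
  · exact (integrable_pker hc).mul_const M
  · refine ae_of_all _ fun p => Tendsto.const_mul _ ?_
    have : Continuous fun x : ℝ × ℝ × ℝ => g (x.1 * p.1 + x.2.1,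
        x.1 ^ 2 * p.2 + (x.2.2 + (1 / 2) * (x.1 * p.1 + x.2.1) * x.1)) := hgc.comp (by fun_prop)
    simpa using this.tendsto ((0 : ℝ), x0.1, x0.2)

theorem integral_k1_mul_eq_sign_mul {c : ℝ} (hc : 0 ≤ c) {g : ℝ × ℝ → ℝ} (hgc : Continuous g)
    (hg : HasCompactSupport g) {x : ℝ × ℝ × ℝ} (hx : x.1 ≠ 0) :
    ∫ y, k1 c x y * g y = SignType.sign x.1 * ∫ p : ℝ × ℝ, pker c p * g (x.1 * p.1 + x.2.1,
      x.1 ^ 2 * p.2 + (x.2.2 + (1 / 2) * (x.1 * p.1 + x.2.1) * x.1)) := by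
  obtain ⟨M, hM⟩ := hgc.bounded_above_of_compact_support hg
  refine integral_k1_mul_eq c hgc hg hx ((integrable_pker hc).mul_bdd (c := M) ?_ ?_)
  · exact (hgc.comp (by fun_prop)).aestronglyMeasurable
  · exact ae_of_all _ fun p => hM _

/-- The fourth power of the homogeneous norm. -/
def rho (y : ℝ × ℝ × ℝ) : ℝ := (y.1 ^ 2 + y.2.1 ^ 2) ^ 2 + 16 * y.2.2 ^ 2

theorem contDiff_rho {n : WithTop ℕ∞} : ContDiff ℝ n rho := by
  unfold rho; fun_prop

theorem rho_nonneg (y : ℝ × ℝ × ℝ) : 0 ≤ rho y := by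
  unfold rho; positivity

theorem hasCompactSupport_comp_rho {f : ℝ → ℝ} (hf : ∀ v, 1 < v → f v = 0) :
    HasCompactSupport fun y => f (rho y) := by
  refine HasCompactSupport.intro
    (isCompact_Icc (a := ((-1 : ℝ), (-1 : ℝ), (-1 : ℝ))) (b := ((1 : ℝ), (1 : ℝ), (1 : ℝ)))) ?_
  intro y hy
  refine hf _ (not_le.1 fun h => hy ?_)
  have key : ∀ t : ℝ, t ^ 2 ≤ 1 → -1 ≤ t ∧ t ≤ 1 := fun t ht =>
    abs_le.1 ((sq_le_one_iff_abs_le_one t).1 ht)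
  unfold rho at h
  have h3 : y.2.2 ^ 2 ≤ 1 := by nlinarith [sq_nonneg (y.1 ^ 2 + y.2.1 ^ 2), sq_nonneg y.2.2]
  have hr : y.1 ^ 2 + y.2.1 ^ 2 ≤ 1 := by
    nlinarith [sq_nonneg y.2.2, sq_nonneg y.1, sq_nonneg y.2.1]
  have h1 := key y.1 (by nlinarith [sq_nonneg y.2.1])
  have h2 := key y.2.1 (by nlinarith [sq_nonneg y.1])
  have h3 := key y.2.2 h3
  exact ⟨⟨h1.1, h2.1, h3.1⟩, h1.2, h2.2, h3.2⟩

theorem fderiv_apply_eq_of_line {F : ℝ × ℝ × ℝ → ℝ} {x v : ℝ × ℝ × ℝ} {d : ℝ}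
    (hF : DifferentiableAt ℝ F x)
    (h : HasDerivAt (fun t : ℝ => F (x.1 + t * v.1, x.2.1 + t * v.2.1, x.2.2 + t * v.2.2)) d 0) :
    fderiv ℝ F x v = d := by
  rw [← hF.lineDeriv_eq_fderiv]
  exact HasLineDerivAt.lineDeriv h

theorem hasDerivAt_add_mul_const (a b t : ℝ) : HasDerivAt (fun t : ℝ => a + t * b) b t := by
  simpa using ((hasDerivAt_id t).mul_const b).const_add a

theorem hasDerivAt_rho_line (x v : ℝ × ℝ × ℝ) :
    HasDerivAt (fun t : ℝ => rho (x.1 + t * v.1, x.2.1 + t * v.2.1, x.2.2 + t * v.2.2))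
      (4 * (x.1 ^ 2 + x.2.1 ^ 2) * (x.1 * v.1 + x.2.1 * v.2.1) + 32 * x.2.2 * v.2.2) 0 := by
  have h := ((((hasDerivAt_add_mul_const x.1 v.1 0).pow 2).add
    ((hasDerivAt_add_mul_const x.2.1 v.2.1 0).pow 2)).pow 2).add
    (((hasDerivAt_add_mul_const x.2.2 v.2.2 0).pow 2).const_mul 16)
  refine h.congr_deriv ?_
  simp
  ring

theorem subLap_comp_rho {f f' f'' : ℝ → ℝ} (hf : ∀ v, HasDerivAt f (f' v) v)
    (hf' : ∀ v, HasDerivAt f' (f'' v) v) (x : ℝ × ℝ × ℝ) :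
    subLap (fun y => f (rho y)) x =
      (x.1 ^ 2 + x.2.1 ^ 2) * (16 * rho x * f'' (rho x) + 24 * f' (rho x)) := by
  have hρ : Differentiable ℝ rho := contDiff_rho.differentiable one_ne_zero
  have hline : ∀ {F F' : ℝ → ℝ}, (∀ v, HasDerivAt F (F' v) v) → ∀ x v : ℝ × ℝ × ℝ,
      HasDerivAt (fun t : ℝ => F (rho (x.1 + t * v.1, x.2.1 + t * v.2.1, x.2.2 + t * v.2.2)))
        (F' (rho x) *
          (4 * (x.1 ^ 2 + x.2.1 ^ 2) * (x.1 * v.1 + x.2.1 * v.2.1) + 32 * x.2.2 * v.2.2)) 0 := by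
    intro F F' hF x v
    have := (hF (rho (x.1 + 0 * v.1, x.2.1 + 0 * v.2.1, x.2.2 + 0 * v.2.2))).comp 0
      (hasDerivAt_rho_line x v)
    simp only [zero_mul, add_zero] at this
    exact this
  have hd : ∀ {F F' : ℝ → ℝ}, (∀ v, HasDerivAt F (F' v) v) →
      Differentiable ℝ fun y => F (rho y) := fun hF =>
    Differentiable.comp (fun v => (hF v).differentiableAt) hρ
  have e1 : X1d (fun y => f (rho y)) = fun y =>
      f' (rho y) * (4 * (y.1 ^ 2 + y.2.1 ^ 2) * y.1 - 16 * y.2.1 * y.2.2) := by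
    ext y
    refine fderiv_apply_eq_of_line (hd hf y) ((hline hf y _).congr_deriv ?_)
    ring
  have e2 : X2d (fun y => f (rho y)) = fun y =>
      f' (rho y) * (4 * (y.1 ^ 2 + y.2.1 ^ 2) * y.2.1 + 16 * y.1 * y.2.2) := by
    ext y
    refine fderiv_apply_eq_of_line (hd hf y) ((hline hf y _).congr_deriv ?_)
    ring
  have l1 : ∀ v : ℝ × ℝ × ℝ, HasDerivAt (fun t : ℝ => x.1 + t * v.1) v.1 0 :=
    fun v => hasDerivAt_add_mul_const _ _ _
  have l2 : ∀ v : ℝ × ℝ × ℝ, HasDerivAt (fun t : ℝ => x.2.1 + t * v.2.1) v.2.1 0 :=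
    fun v => hasDerivAt_add_mul_const _ _ _
  have l3 : ∀ v : ℝ × ℝ × ℝ, HasDerivAt (fun t : ℝ => x.2.2 + t * v.2.2) v.2.2 0 :=
    fun v => hasDerivAt_add_mul_const _ _ _
  have e11 : X1d (X1d (fun y => f (rho y))) x =
      f'' (rho x) * (4 * (x.1 ^ 2 + x.2.1 ^ 2) * x.1 - 16 * x.2.1 * x.2.2) ^ 2 +
        f' (rho x) * (12 * (x.1 ^ 2 + x.2.1 ^ 2)) := by
    rw [e1]
    refine fderiv_apply_eq_of_line ((hd hf').mul (by fun_prop) x) ?_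
    refine ((hline hf' x _).mul ((((((l1 _).pow 2).add ((l2 _).pow 2)).const_mul 4).mul
      (l1 _)).sub (((l2 _).const_mul 16).mul (l3 _)))).congr_deriv ?_
    simp
    ring
  have e22 : X2d (X2d (fun y => f (rho y))) x =
      f'' (rho x) * (4 * (x.1 ^ 2 + x.2.1 ^ 2) * x.2.1 + 16 * x.1 * x.2.2) ^ 2 +
        f' (rho x) * (12 * (x.1 ^ 2 + x.2.1 ^ 2)) := by
    rw [e2]
    refine fderiv_apply_eq_of_line ((hd hf').mul (by fun_prop) x) ?_
    refine ((hline hf' x _).mul ((((((l1 _).pow 2).add ((l2 _).pow 2)).const_mul 4).mul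
      (l2 _)).add (((l1 _).const_mul 16).mul (l3 _)))).congr_deriv ?_
    simp
    ring
  rw [subLap, e11, e22, rho]
  ring

theorem integral_radial (k : ℝ → ℝ) :
    ∫ z : ℝ × ℝ, k (z.1 ^ 2 + z.2 ^ 2) =
      2 * Real.pi * ∫ R in Set.Ioi (0 : ℝ), R * k (R ^ 2) := by
  have h : ∀ p : ℝ × ℝ, p.1 • k ((polarCoord.symm p).1 ^ 2 + (polarCoord.symm p).2 ^ 2) =
      p.1 * k (p.1 ^ 2) * 1 := fun p => by
    rw [polarCoord_symm_apply, smul_eq_mul, mul_one, mul_pow, mul_pow, ← mul_add,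
      Real.cos_sq_add_sin_sq, mul_one]
  rw [← integral_comp_polarCoord_symm fun z => k (z.1 ^ 2 + z.2 ^ 2)]
  simp_rw [h]
  rw [polarCoord_target, Measure.volume_eq_prod,
    setIntegral_prod_mul (fun R : ℝ => R * k (R ^ 2)) (fun _ : ℝ => (1 : ℝ))]
  have : ∫ _ in Set.Ioo (-Real.pi) Real.pi, (1 : ℝ) = 2 * Real.pi := by
    rw [setIntegral_const, Measure.real, Real.volume_Ioo, ENNReal.toReal_ofReal
      (by linarith [Real.pi_pos]), smul_eq_mul]
    ring
  rw [this, mul_comm]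

theorem integral_pow_three_mul_comp (q : ℝ → ℝ) (a : ℝ) :
    ∫ R in Set.Ioi (0 : ℝ), R * (R ^ 2 * q ((R ^ 2) ^ 2 + a)) =
      (1 / 4) * ∫ v in Set.Ioi a, q v := by
  have h1 : ∫ v in Set.Ioi a, q v = ∫ v in Set.Ioi (0 : ℝ), q (v + a) := by
    rw [← integral_indicator measurableSet_Ioi, ← integral_indicator measurableSet_Ioi,
      ← integral_add_right_eq_self _ a]
    congr 1 with v
    simp [Set.indicator]
  rw [h1, ← integral_comp_rpow_Ioi_of_pos (g := fun v => q (v + a)) (p := 4) (by norm_num),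
    ← integral_const_mul]
  refine setIntegral_congr_fun measurableSet_Ioi fun R _ => ?_
  have e3 : R ^ ((4 : ℝ) - 1) = R ^ 3 := by
    rw [← Real.rpow_natCast R 3]; norm_num
  have e4 : R ^ (4 : ℝ) = (R ^ 2) ^ 2 := by
    rw [← pow_mul, ← Real.rpow_natCast R (2 * 2)]; norm_num
  simp only [e3, e4, smul_eq_mul]
  ring

theorem setOf_mul_sq_lt_eq_Ioo (v : ℝ) :
    {s : ℝ | 16 * s ^ 2 < v} = Set.Ioo (-(√v / 4)) (√v / 4) := by
  ext s
  rw [Set.mem_ofPred_eq, Set.mem_Ioo, ← abs_lt, lt_div_iff₀ (by norm_num),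
    Real.lt_sqrt (by positivity), mul_pow, sq_abs]
  constructor <;> intro h <;> linarith

theorem integral_indicator_mul_sq_lt (v w : ℝ) :
    ∫ s : ℝ, {s : ℝ | 16 * s ^ 2 < v}.indicator (fun _ => w) s = w * (√v / 2) := by
  rw [setOf_mul_sq_lt_eq_Ioo, integral_indicator measurableSet_Ioo, setIntegral_const,
    Measure.real, Real.volume_Ioo, ENNReal.toReal_ofReal (by linarith [Real.sqrt_nonneg v]),
    smul_eq_mul]
  ring

theorem rpow_neg_half_mul_sqrt (v w : ℝ) :
    v ^ (-(1 : ℝ) / 2) * w * (√v / 2) = (Set.Ioi (0 : ℝ)).indicator (fun _ => w / 2) v := by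
  by_cases hv : 0 < v
  · have : v ^ (-(1 : ℝ) / 2) = (√v)⁻¹ := by
      rw [Real.sqrt_eq_rpow, ← Real.rpow_neg hv.le]; norm_num
    have := Real.sqrt_pos.2 hv
    simp only [Set.indicator, Set.mem_Ioi, if_true, *]
    field_simp
  · simp [Set.indicator, hv, Real.sqrt_eq_zero_of_nonpos (not_lt.1 hv)]

theorem integral_integral_Ioi_rpow_mul {G : ℝ → ℝ} (hGm : Measurable G) (hG : Integrable G) :
    ∫ s : ℝ, ∫ v in Set.Ioi (16 * s ^ 2), v ^ (-(1 : ℝ) / 2) * G v =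
      (1 / 2) * ∫ v in Set.Ioi (0 : ℝ), G v := by
  set q : ℝ → ℝ := fun v => v ^ (-(1 : ℝ) / 2) * G v with hq
  have hqm : Measurable q := (measurable_id.pow_const _).mul hGm
  have hn : ∀ v : ℝ, ‖q v‖ * (√v / 2) = (Set.Ioi (0 : ℝ)).indicator (fun v => ‖G v‖ / 2) v := by
    intro v
    by_cases hv : 0 ≤ v
    · have := rpow_neg_half_mul_sqrt v ‖G v‖
      rw [hq, norm_mul, Real.norm_of_nonneg (Real.rpow_nonneg hv _), this]
      rfl
    · simp [Set.indicator, (lt_of_not_ge hv).not_gt, Real.sqrt_eq_zero_of_nonpos (not_le.1 hv).le]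
  set K : ℝ → ℝ → ℝ := fun s v => {s : ℝ | 16 * s ^ 2 < v}.indicator (fun _ => q v) s with hK
  have hKm : Measurable (Function.uncurry K) := by
    have : Function.uncurry K = {p : ℝ × ℝ | 16 * p.1 ^ 2 < p.2}.indicator (fun p => q p.2) := by
      ext p; rfl
    rw [this]
    exact (hqm.comp measurable_snd).indicator (measurableSet_lt (by fun_prop) (by fun_prop))
  have hKi : Integrable (Function.uncurry K) (volume.prod volume) := by
    rw [integrable_prod_iff' hKm.aestronglyMeasurable]
    refine ⟨ae_of_all _ fun v => ?_, ?_⟩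
    · simp only [Function.uncurry_apply_pair, hK]
      rw [setOf_mul_sq_lt_eq_Ioo, integrable_indicator_iff measurableSet_Ioo]
      exact integrableOn_const (by simp)
    · simp only [Function.uncurry_apply_pair, hK, norm_indicator_eq_indicator_norm,
        integral_indicator_mul_sq_lt, hn]
      exact (hG.norm.div_const 2).indicator measurableSet_Ioi
  have e : ∀ s : ℝ, ∫ v in Set.Ioi (16 * s ^ 2), q v = ∫ v, K s v := fun s => by
    rw [← integral_indicator measurableSet_Ioi]; rfl
  simp_rw [e]
  rw [integral_integral_swap hKi]
  simp only [hK, integral_indicator_mul_sq_lt, hq, rpow_neg_half_mul_sqrt]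
  rw [← integral_const_mul, ← integral_indicator measurableSet_Ioi]
  congr 1 with v
  simp only [Set.indicator]
  split_ifs <;> ring

theorem integral_rho_rpow_mul {G : ℝ → ℝ} (hGc : Continuous G) (hG : Integrable G)
    (hG1 : ∀ v, 1 < v → G v = 0) :
    ∫ y, rho y ^ (-(1 : ℝ) / 2) * ((y.1 ^ 2 + y.2.1 ^ 2) * G (rho y)) =
      (Real.pi / 4) * ∫ v in Set.Ioi (0 : ℝ), G v := by
  set H : ℝ × ℝ × ℝ → ℝ := fun y => rho y ^ (-(1 : ℝ) / 2) * ((y.1 ^ 2 + y.2.1 ^ 2) * G (rho y))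
    with hH
  have hρ : Continuous rho := (contDiff_rho (n := 0)).continuous
  have hGρ : Integrable fun y => G (rho y) :=
    (hGc.comp hρ).integrable_of_hasCompactSupport (hasCompactSupport_comp_rho hG1)
  have hHi : Integrable H := by
    refine hGρ.mono ?_ (ae_of_all _ fun y => ?_)
    · refine ((hρ.measurable.pow_const _).mul ?_).aestronglyMeasurable
      exact Continuous.measurable (by fun_prop)
    · have hr : 0 ≤ y.1 ^ 2 + y.2.1 ^ 2 := by positivity
      have h0 : rho y ^ (-(1 : ℝ) / 2) * (y.1 ^ 2 + y.2.1 ^ 2) ≤ 1 := by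
        have hs : rho y ^ (-(1 : ℝ) / 2) = (√(rho y))⁻¹ := by
          rw [Real.sqrt_eq_rpow, ← Real.rpow_neg (rho_nonneg y)]; norm_num
        rw [hs, inv_mul_eq_div]
        refine div_le_one_of_le₀ (Real.le_sqrt_of_sq_le ?_) (Real.sqrt_nonneg _)
        unfold rho
        nlinarith [sq_nonneg y.2.2]
      simp only [hH]
      rw [← mul_assoc, norm_mul, Real.norm_of_nonneg
        (mul_nonneg (Real.rpow_nonneg (rho_nonneg y) _) hr)]
      exact mul_le_of_le_one_left (norm_nonneg _) h0
  have hP := volume_preserving_prodAssoc (α₁ := ℝ) (β₁ := ℝ) (γ₁ := ℝ)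
  have hHP : Integrable (fun z => H (MeasurableEquiv.prodAssoc z)) (volume.prod volume) :=
    (hP.integrable_comp_emb MeasurableEquiv.prodAssoc.measurableEmbedding).2 hHi
  rw [← hP.integral_comp MeasurableEquiv.prodAssoc.measurableEmbedding H,
    Measure.volume_eq_prod, integral_prod_symm _ hHP]
  have hs : ∀ s : ℝ, ∫ z : ℝ × ℝ, H (MeasurableEquiv.prodAssoc (z, s)) =
      (Real.pi / 2) * ∫ v in Set.Ioi (16 * s ^ 2), v ^ (-(1 : ℝ) / 2) * G v := by
    intro s
    have e : ∀ z : ℝ × ℝ, H (MeasurableEquiv.prodAssoc (z, s)) =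
        (fun r : ℝ => r * ((r ^ 2 + 16 * s ^ 2) ^ (-(1 : ℝ) / 2) * G (r ^ 2 + 16 * s ^ 2)))
          (z.1 ^ 2 + z.2 ^ 2) := fun z => by
      simp only [hH, rho, MeasurableEquiv.prodAssoc, MeasurableEquiv.coe_mk, Equiv.prodAssoc_apply]
      ring
    rw [integral_congr_ae (ae_of_all _ e), integral_radial (fun r : ℝ =>
      r * ((r ^ 2 + 16 * s ^ 2) ^ (-(1 : ℝ) / 2) * G (r ^ 2 + 16 * s ^ 2))), integral_pow_three_mul_comp
      (fun v => v ^ (-(1 : ℝ) / 2) * G v) (16 * s ^ 2)]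
    ring
  simp_rw [hs]
  rw [integral_const_mul, integral_integral_Ioi_rpow_mul hGc.measurable hG]
  ring

theorem IsNormalizing.mul_pi_eq {c : ℝ} (h : IsNormalizing c) : c * Real.pi = 1 / 2 := by
  set f : ℝ → ℝ := fun v => Real.smoothTransition (1 - v) with hf
  have hfs : ContDiff ℝ (⊤ : ℕ∞) f := Real.smoothTransition.contDiff.comp (by fun_prop)
  have hf's : ContDiff ℝ (⊤ : ℕ∞) (deriv f) := (contDiff_infty_iff_deriv.1 hfs).2
  have hf''s : ContDiff ℝ (⊤ : ℕ∞) (deriv (deriv f)) := (contDiff_infty_iff_deriv.1 hf's).2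
  have hd : ∀ v, HasDerivAt f (deriv f v) v := fun v =>
    ((hfs.differentiable (by simp)) v).hasDerivAt
  have hd' : ∀ v, HasDerivAt (deriv f) (deriv (deriv f) v) v := fun v =>
    ((hf's.differentiable (by simp)) v).hasDerivAt
  have hf1 : ∀ v, 1 ≤ v → f v = 0 := fun v hv =>
    Real.smoothTransition.zero_of_nonpos (by linarith)
  have hf0 : ∀ v, v ≤ 0 → f v = 1 := fun v hv =>
    Real.smoothTransition.one_of_one_le (by linarith)
  have hlocal : ∀ {F : ℝ → ℝ} {a : ℝ}, (∀ v, 1 < v → F v = a) → ∀ v, 1 < v → deriv F v = 0 := by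
    intro F a hF v hv
    have h : F =ᶠ[nhds v] fun _ => a := (eventually_gt_nhds hv).mono hF
    rw [h.deriv_eq, deriv_const]
  have hlocal' : ∀ {F : ℝ → ℝ} {a : ℝ}, (∀ v, v < 0 → F v = a) → ∀ v, v < 0 → deriv F v = 0 := by
    intro F a hF v hv
    have h : F =ᶠ[nhds v] fun _ => a := (eventually_lt_nhds hv).mono hF
    rw [h.deriv_eq, deriv_const]
  have hd1 := hlocal fun v hv => hf1 v (le_of_lt hv)
  have hd0 := hlocal' fun v hv => hf0 v (le_of_lt hv)
  have hdd1 := hlocal hd1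
  have hdd0 := hlocal' hd0
  set G : ℝ → ℝ := fun v => 16 * v * deriv (deriv f) v + 24 * deriv f v with hGdef
  have hGc : Continuous G := by
    have := hf's.continuous
    have := hf''s.continuous
    fun_prop
  have hG1 : ∀ v, 1 < v → G v = 0 := fun v hv => by simp [hGdef, hd1 v hv, hdd1 v hv]
  have hGi : Integrable G := by
    refine hGc.integrable_of_hasCompactSupport (HasCompactSupport.intro
      (isCompact_Icc (a := (0 : ℝ)) (b := 1)) fun v hv => ?_)
    by_cases h1 : 1 < v
    · exact hG1 v h1
    · have h0 : v < 0 := not_le.1 fun h0 => hv ⟨h0, not_lt.1 h1⟩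
      simp [hGdef, hd0 v h0, hdd0 v h0]
  have hGint : ∫ v in Set.Ioi (0 : ℝ), G v = -8 := by
    have hW : ∀ v ∈ Set.Ici (0 : ℝ), HasDerivAt (fun v => 16 * v * deriv f v + 8 * f v) (G v) v := by
      intro v _
      refine ((((hasDerivAt_id v).const_mul 16).mul (hd' v)).add
        ((hd v).const_mul 8)).congr_deriv ?_
      simp [hGdef]
      ring
    have hlim : Tendsto (fun v => 16 * v * deriv f v + 8 * f v) atTop (nhds 0) := by
      refine tendsto_const_nhds.congr' ?_
      filter_upwards [eventually_gt_atTop 1] with v hv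
      simp [hd1 v hv, hf1 v hv.le]
    rw [integral_Ioi_of_hasDerivAt_of_tendsto' hW hGi.integrableOn hlim]
    simp [hf0 0 le_rfl]
  have key := h (fun y => f (rho y)) (hfs.comp contDiff_rho)
    (hasCompactSupport_comp_rho fun v hv => hf1 v hv.le)
  have e : ∀ y, Gam c 0 y * subLap (fun y => f (rho y)) y =
      c * (rho y ^ (-(1 : ℝ) / 2) * ((y.1 ^ 2 + y.2.1 ^ 2) * G (rho y))) := by
    intro y
    have : Gam c 0 y = c * rho y ^ (-(1 : ℝ) / 2) := by
      simp [Gam, rho]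
    rw [this, subLap_comp_rho hd hd', mul_assoc]
  simp_rw [e] at key
  rw [integral_const_mul, integral_rho_rpow_mul hGc hGi hG1, hGint] at key
  have hρ0 : rho 0 = 0 := by simp [rho]
  rw [hρ0, hf0 0 le_rfl] at key
  linarith

/-- Jump relations for the degenerate part `K₁` of the double layer
potential across the vertical plane `Π`. -/
theorem stmt2 (c : ℝ) (hc : 0 < c) (hnorm : IsNormalizing c)
    (g : ℝ × ℝ → ℝ) (hg : HasCompactSupport g)
    (L : ℝ) (hLip : ∀ a b : ℝ × ℝ, |g a - g b| ≤ L * dt a b)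
    (x0 : ℝ × ℝ) :
    Tendsto (fun x : ℝ × ℝ × ℝ => ∫ y, k1 c x y * g y)
      (nhdsWithin ((0 : ℝ), x0.1, x0.2) {x : ℝ × ℝ × ℝ | 0 < x.1})
      (nhds ((1 / 2) * g x0)) ∧
    Tendsto (fun x : ℝ × ℝ × ℝ => ∫ y, k1 c x y * g y)
      (nhdsWithin ((0 : ℝ), x0.1, x0.2) {x : ℝ × ℝ × ℝ | x.1 < 0})
      (nhds (-(1 / 2) * g x0)) := by
  have hgc := continuous_of_dt_lipschitz hLip
  have h := tendsto_integral_pker_mul hc.le hgc hg x0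
  rw [hnorm.mul_pi_eq] at h
  constructor
  · refine (h.mono_left nhdsWithin_le_nhds).congr' ?_
    filter_upwards [self_mem_nhdsWithin] with x hx
    rw [integral_k1_mul_eq_sign_mul hc.le hgc hg (ne_of_gt hx), sign_pos hx]
    simp
  · rw [neg_mul]
    refine (h.mono_left nhdsWithin_le_nhds).neg.congr' ?_
    filter_upwards [self_mem_nhdsWithin] with x hx
    rw [integral_k1_mul_eq_sign_mul hc.le hgc hg (ne_of_lt hx), sign_neg hx]
    simp
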